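/- For every integer k ≥ 0, no smallest counterexample contains a (2,2,k)-vertex, i.e., a vertex of degree three that is an end of two 2-strings and a k-string. -/

import Mathlib

open SimpleGraph

/-- The degree of a vertex, as the cardinality of its neighbor set. -/
noncomputable def deg {V : Type} (G : SimpleGraph V) (v : V) : ℕ :=
  (G.neighborSet v).ncard

/-- The potential of a finite graph: `5 n(G) - 4 e(G)`. -/
noncomputable def pot {V : Type} [Fintype V] (G : SimpleGraph V) : ℤ :=
  5 * (Fintype.card V : ℤ) - 4 * (G.edgeSet.ncard : ℤ)

/-- A graph is 5/2-critical if it has no homomorphism to the 5-cycle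
but every proper subgraph has one. -/
def Critical52 {V : Type} (G : SimpleGraph V) : Prop :=
  IsEmpty (G →g cycleGraph 5) ∧
  ∀ H : G.Subgraph, H ≠ ⊤ → Nonempty (H.coe →g cycleGraph 5)

/-- The exceptional graph `E₁`: a 9-cycle `0 1 2 3 4 5 6 7 8` together
with a vertex `9` adjacent to `0`, `3` and `6`. -/
def E1 : SimpleGraph (Fin 10) := SimpleGraph.fromEdgeSet
  {s(0,1), s(1,2), s(2,3), s(3,4), s(4,5), s(5,6), s(6,7), s(7,8), s(8,0),
   s(9,0), s(9,3), s(9,6)}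

/-- The exceptional graph `E₂`: two 5-cycles `0 1 2 3 4` and `0 1 5 6 7`
sharing exactly the edge `01`, together with a path `3 8 9 6`. -/
def E2 : SimpleGraph (Fin 10) := SimpleGraph.fromEdgeSet
  {s(0,1), s(1,2), s(2,3), s(3,4), s(4,0),
   s(1,5), s(5,6), s(6,7), s(7,0),
   s(3,8), s(8,9), s(9,6)}

/-- A smallest counterexample: a 5/2-critical graph, not isomorphic to `C₃`, `E₁`, `E₂`,
with potential at least 2, such that every smaller 5/2-critical graph not isomorphic
to `C₃`, `E₁`, `E₂` has potential at most 1. -/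
def SmallestCex {V : Type} [Fintype V] (G : SimpleGraph V) : Prop :=
  Critical52 G ∧ IsEmpty (G ≃g cycleGraph 3) ∧ IsEmpty (G ≃g E1) ∧ IsEmpty (G ≃g E2) ∧
  2 ≤ pot G ∧
  ∀ (m : ℕ) (H : SimpleGraph (Fin m)), Critical52 H →
    IsEmpty (H ≃g cycleGraph 3) → IsEmpty (H ≃g E1) → IsEmpty (H ≃g E2) →
    m < Fintype.card V → pot H ≤ 1

/-- A string: a path of positive length whose endvertices have degree at least 3
and whose internal vertices have degree 2. A `k`-string is a string of length `k+1`. -/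
def IsString {V : Type} (G : SimpleGraph V) {u v : V} (p : G.Walk u v) : Prop :=
  p.IsPath ∧ 0 < p.length ∧ 3 ≤ deg G u ∧ 3 ≤ deg G v ∧
  ∀ w ∈ p.support, w ≠ u → w ≠ v → deg G w = 2

/-- `v` lies on a 5-cycle of `G`. -/
def InFiveCycle {V : Type} (G : SimpleGraph V) (v : V) : Prop :=
  ∃ (w : V) (c : G.Walk w w), c.IsCycle ∧ c.length = 5 ∧ v ∈ c.support

/-- `v` is a `(k₁,k₂,k₃)`-vertex: it has degree 3 and is the end of a `k₁`-string,
a `k₂`-string and a `k₃`-string leaving `v` through its three distinct edges. -/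
def IsVertex3 {V : Type} (G : SimpleGraph V) (v : V) (k1 k2 k3 : ℕ) : Prop :=
  deg G v = 3 ∧ ∃ (u1 u2 u3 : V) (p1 : G.Walk v u1) (p2 : G.Walk v u2) (p3 : G.Walk v u3),
    IsString G p1 ∧ IsString G p2 ∧ IsString G p3 ∧
    p1.getVert 1 ≠ p2.getVert 1 ∧ p1.getVert 1 ≠ p3.getVert 1 ∧ p2.getVert 1 ≠ p3.getVert 1 ∧
    p1.length = k1 + 1 ∧ p2.length = k2 + 1 ∧ p3.length = k3 + 1

/-- `v` is a `(k₁,k₂,k₃,k₄)`-vertex: it has degree 4 and is the end of strings of the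
corresponding lengths leaving `v` through its four distinct edges. -/
def IsVertex4 {V : Type} (G : SimpleGraph V) (v : V) (k1 k2 k3 k4 : ℕ) : Prop :=
  deg G v = 4 ∧ ∃ (u1 u2 u3 u4 : V) (p1 : G.Walk v u1) (p2 : G.Walk v u2)
    (p3 : G.Walk v u3) (p4 : G.Walk v u4),
    IsString G p1 ∧ IsString G p2 ∧ IsString G p3 ∧ IsString G p4 ∧
    p1.getVert 1 ≠ p2.getVert 1 ∧ p1.getVert 1 ≠ p3.getVert 1 ∧ p1.getVert 1 ≠ p4.getVert 1 ∧
    p2.getVert 1 ≠ p3.getVert 1 ∧ p2.getVert 1 ≠ p4.getVert 1 ∧ p3.getVert 1 ≠ p4.getVert 1 ∧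
    p1.length = k1 + 1 ∧ p2.length = k2 + 1 ∧ p3.length = k3 + 1 ∧ p4.length = k4 + 1

/-- `H` contains at least two distinct cycles, where cycles are counted as subgraphs,
i.e. two cycles are distinct if their edge sets differ. -/
def TwoDistinctCycles {V : Type} (H : SimpleGraph V) : Prop :=
  ∃ (v1 v2 : V) (c1 : H.Walk v1 v1) (c2 : H.Walk v2 v2),
    c1.IsCycle ∧ c2.IsCycle ∧ {e | e ∈ c1.edges} ≠ {e | e ∈ c2.edges}

/-- The degree of a 5-cycle (cell) `c` in `G`: the number of strings not contained in `c`
that intersect `c`, strings being counted by their edge sets. -/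
noncomputable def cellDegree {V : Type} (G : SimpleGraph V) {w : V} (c : G.Walk w w) : ℕ :=
  {S : Set (Sym2 V) | ∃ (u v : V) (p : G.Walk u v), IsString G p ∧ S = {e | e ∈ p.edges} ∧
    ¬ S ⊆ {e | e ∈ c.edges} ∧ ∃ x ∈ p.support, x ∈ c.support}.ncard

/-- Adjacency in the five-cycle. -/
abbrev c5 (x y : Fin 5) : Prop := (cycleGraph 5).Adj x y

lemma c5_path3 : ∀ x y : Fin 5, x ≠ y → ∃ p q, c5 x p ∧ c5 p q ∧ c5 q y := by decide

lemma c5_path2 : ∀ x y p : Fin 5, c5 x p → c5 p y → ¬ c5 x y := by decide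

lemma c5_ex : ∀ x : Fin 5, ∃ y, c5 x y := by decide

lemma c5_bad : ∀ x1 x2 xc : Fin 5, (∀ y, c5 y xc → y = x1 ∨ y = x2) →
    c5 x1 xc ∧ c5 x2 xc ∧ x1 ≠ x2 := by decide

lemma c5_notri : ∀ x y z : Fin 5, c5 x y → c5 y z → c5 x z → False := by decide

/-- Edges of the five-cycle inside a vertex subset. -/
def c5E (X : Finset (Fin 5)) : Finset (Sym2 (Fin 5)) :=
  (cycleGraph 5).edgeFinset.filter (fun e => ∀ x ∈ e, x ∈ X)

lemma c5E_card : ∀ X : Finset (Fin 5), X.Nonempty →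
    4 * (c5E X).card + 5 ≤ 5 * X.card ∧ (X.card = 2 → (c5E X).card ≤ 1) := by
  decide +kernel

instance E1.decAdj : DecidableRel E1.Adj := fun x y =>
  decidable_of_iff ((s(x,y) = s(0,1) ∨ s(x,y) = s(1,2) ∨ s(x,y) = s(2,3) ∨ s(x,y) = s(3,4) ∨
    s(x,y) = s(4,5) ∨ s(x,y) = s(5,6) ∨ s(x,y) = s(6,7) ∨ s(x,y) = s(7,8) ∨ s(x,y) = s(8,0) ∨
    s(x,y) = s(9,0) ∨ s(x,y) = s(9,3) ∨ s(x,y) = s(9,6)) ∧ x ≠ y)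
    (by simp only [E1, fromEdgeSet_adj, Set.mem_insert_iff, Set.mem_singleton_iff])

instance E2.decAdj : DecidableRel E2.Adj := fun x y =>
  decidable_of_iff ((s(x,y) = s(0,1) ∨ s(x,y) = s(1,2) ∨ s(x,y) = s(2,3) ∨ s(x,y) = s(3,4) ∨
    s(x,y) = s(4,0) ∨ s(x,y) = s(1,5) ∨ s(x,y) = s(5,6) ∨ s(x,y) = s(6,7) ∨ s(x,y) = s(7,0) ∨
    s(x,y) = s(3,8) ∨ s(x,y) = s(8,9) ∨ s(x,y) = s(9,6)) ∧ x ≠ y)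
    (by simp only [E2, fromEdgeSet_adj, Set.mem_insert_iff, Set.mem_singleton_iff])

lemma ncard_edgeSet_eq {V : Type} [Fintype V] [DecidableEq V] (G : SimpleGraph V)
    [DecidableRel G.Adj] : G.edgeSet.ncard = G.edgeFinset.card := by
  rw [← coe_edgeFinset, Set.ncard_coe_finset]

lemma E1_edges : E1.edgeSet.ncard = 12 := by
  rw [ncard_edgeSet_eq]; decide +kernel

lemma E2_edges : E2.edgeSet.ncard = 12 := by
  rw [ncard_edgeSet_eq]; decide +kernel

lemma C3_edges : (cycleGraph 3).edgeSet.ncard = 3 := by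
  rw [ncard_edgeSet_eq]; decide +kernel

/-- Colourings of `E1` minus a vertex. -/
def tab1 : Fin 10 → List (Fin 10 → Fin 5) :=
  ![ [], [![0,0,1,0,1,2,3,2,1,4], ![0,0,1,0,4,3,2,3,4,1]],
    [![0,1,0,0,1,2,3,2,1,4], ![0,1,0,0,4,3,2,3,4,1]], [],
    [![0,1,2,3,0,2,3,2,1,4], ![0,1,2,3,0,4,3,2,1,4]],
    [![0,1,2,3,2,0,3,2,1,4], ![0,1,2,3,4,0,3,2,1,4]], [],
    [![0,1,2,3,2,1,0,0,1,4], ![0,1,2,3,2,1,0,0,4,4]],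
    [![0,1,2,3,2,1,0,1,0,4], ![0,1,2,3,2,1,0,4,0,4]], []]

/-- Colourings of `E2` minus a vertex. -/
def tab2 : Fin 10 → List (Fin 10 → Fin 5) :=
  ![ [], [], [![0,1,0,2,1,2,3,4,1,2], ![0,1,0,0,1,2,3,4,1,2]], [],
    [![0,1,0,4,0,2,3,4,0,4], ![0,1,0,1,0,2,3,4,0,4]],
    [![0,1,2,3,4,0,2,1,2,1], ![0,1,2,3,4,0,0,1,2,1]], [],
    [![0,1,2,3,4,0,4,0,4,0], ![0,1,2,3,4,0,1,0,4,0]],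
    [![0,1,2,3,4,2,3,4,0,2], ![0,1,2,3,4,2,3,4,0,4]],
    [![0,1,2,3,4,2,3,4,2,0], ![0,1,2,3,4,2,3,4,4,0]]]

/-- Every degree-two vertex of `E` can be deleted so that the remaining graph has
a colouring which is good for the three given vertices. -/
def GoodExc (E : SimpleGraph (Fin 10)) : Prop :=
  ∀ w a : Fin 10, E.Adj w a → ∀ b, E.Adj w b → a ≠ b → (∀ x, E.Adj w x → x = a ∨ x = b) →
    ∀ u, u ≠ w → ∃ ψ : Fin 10 → Fin 5,
      (∀ x y, x ≠ w → y ≠ w → E.Adj x y → c5 (ψ x) (ψ y)) ∧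
      ¬ (c5 (ψ a) (ψ b) ∧ c5 (ψ u) (ψ b) ∧ ψ a ≠ ψ u)

/-- Boolean adjacency from an edge list. -/
def adjb (L : List (ℕ × ℕ)) (x y : Fin 10) : Bool :=
  L.any fun p => (p.1 == x.val && p.2 == y.val) || (p.1 == y.val && p.2 == x.val)

/-- Boolean adjacency in the five-cycle. -/
def c5b (x y : Fin 5) : Bool := (x.val + 1) % 5 == y.val || (y.val + 1) % 5 == x.val

lemma c5b_iff : ∀ x y, c5b x y = true ↔ c5 x y := by decide

/-- The colourings in the table are proper. -/
def chk1 (L : List (ℕ × ℕ)) (tab : Fin 10 → List (Fin 10 → Fin 5)) : Bool :=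
  (List.finRange 10).all fun w => (tab w).all fun ψ =>
    (List.finRange 10).all fun x => (List.finRange 10).all fun y =>
      x == w || y == w || !adjb L x y || c5b (ψ x) (ψ y)

/-- The colourings in the table suffice. -/
def chk2 (L : List (ℕ × ℕ)) (tab : Fin 10 → List (Fin 10 → Fin 5)) : Bool :=
  (List.finRange 10).all fun w => (List.finRange 10).all fun a => !adjb L w a ||
    ((List.finRange 10).all fun b => !adjb L w b || a == b ||
      !((List.finRange 10).all fun x => !adjb L w x || x == a || x == b) ||
      ((List.finRange 10).all fun u => u == w ||
        (tab w).any fun ψ => !(c5b (ψ a) (ψ b) && c5b (ψ u) (ψ b) && !(ψ a == ψ u))))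

lemma good_of_chk (E : SimpleGraph (Fin 10)) (L : List (ℕ × ℕ))
    (tab : Fin 10 → List (Fin 10 → Fin 5)) (hE : ∀ x y, E.Adj x y ↔ adjb L x y = true)
    (h1 : chk1 L tab = true) (h2 : chk2 L tab = true) : GoodExc E := by
  intro w a ha b hb hab hd u hu
  rw [hE] at ha hb
  simp only [hE] at hd
  simp only [chk1, chk2, List.all_eq_true, List.mem_finRange, true_imp_iff] at h1 h2
  have h3 := h2 w a
  simp only [ha, Bool.not_true, Bool.false_or, List.all_eq_true, List.mem_finRange,
    true_imp_iff] at h3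
  have h4 := h3 b
  have hd' : ((List.finRange 10).all fun x => !adjb L w x || x == a || x == b) = true := by
    simp only [List.all_eq_true, List.mem_finRange, true_imp_iff]
    intro x
    have := hd x
    cases hx : adjb L w x
    · simp
    · rcases this hx with rfl | rfl <;> simp
  have hab' : (a == b) = false := by simpa using hab
  simp only [hb, hd', hab', Bool.not_true, Bool.false_or, List.all_eq_true, List.mem_finRange,
    true_imp_iff] at h4
  have h5 := h4 u
  have hu' : (u == w) = false := by simpa using hu
  simp only [hu', Bool.false_or, List.any_eq_true] at h5
  obtain ⟨ψ, hm, hψ⟩ := h5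
  refine ⟨ψ, ?_, ?_⟩
  · intro x y hx hy hxy
    have := h1 w ψ hm x y
    have hx' : (x == w) = false := by simpa using hx
    have hy' : (y == w) = false := by simpa using hy
    simpa [hx', hy', (hE x y).1 hxy, c5b_iff] using this
  · rintro ⟨q1, q2, q3⟩
    rw [← c5b_iff] at q1 q2
    simp [q1, q2, q3] at hψ

lemma E1_good : GoodExc E1 := by
  refine good_of_chk E1 [(0,1), (1,2), (2,3), (3,4), (4,5), (5,6), (6,7), (7,8), (8,0),
    (9,0), (9,3), (9,6)] tab1 ?_ ?_ ?_
  · decide +kernel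
  · decide +kernel
  · decide +kernel

lemma E2_good : GoodExc E2 := by
  refine good_of_chk E2 [(0,1), (1,2), (2,3), (3,4), (4,0), (1,5), (5,6), (6,7), (7,0),
    (3,8), (8,9), (9,6)] tab2 ?_ ?_ ?_
  · decide +kernel
  · decide +kernel
  · decide +kernel

lemma C3_adj : ∀ x y : Fin 3, x ≠ y → (cycleGraph 3).Adj x y := by decide

/-- `φ` is a colouring of the subgraph of `G` induced by `S`. -/
def Col {V : Type} (G : SimpleGraph V) (S : Set V) (φ : V → Fin 5) : Prop :=
  ∀ x ∈ S, ∀ y ∈ S, G.Adj x y → c5 (φ x) (φ y)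

/-- Extraction of a critical subgraph. -/
lemma exists_critical {V : Type} [Fintype V] (G : SimpleGraph V) (R : Set V)
    (hG : ¬ ∃ φ, Col G R φ) :
    ∃ (m : ℕ) (H : SimpleGraph (Fin m)) (f : Fin m → V), Critical52 H ∧ Function.Injective f ∧
      (∀ i, f i ∈ R) ∧ ∀ i j, H.Adj i j → G.Adj (f i) (f j) := by
  classical
  let P : ℕ → Prop := fun n => ∃ (m : ℕ) (H : SimpleGraph (Fin m)) (f : Fin m → V),
    m + H.edgeSet.ncard = n ∧ IsEmpty (H →g cycleGraph 5) ∧ Function.Injective f ∧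
      (∀ i, f i ∈ R) ∧ ∀ i j, H.Adj i j → G.Adj (f i) (f j)
  have hP : ∃ n, P n := by
    let e := Fintype.equivFin R
    refine ⟨_, Fintype.card R, (G.induce R).comap e.symm, fun i => (e.symm i).1, rfl, ?_, ?_, ?_, ?_⟩
    · constructor
      intro ψ
      apply hG
      refine ⟨fun x => if hx : x ∈ R then ψ (e ⟨x, hx⟩) else 0, ?_⟩
      intro x hx y hy hxy
      simp only [hx, hy, dite_true]
      apply ψ.map_rel
      simpa using hxy
    · intro i j hij
      exact e.symm.injective (Subtype.ext hij)
    · intro i; exact (e.symm i).2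
    · intro i j hij; simpa using hij
  obtain ⟨m, H, f, hn, hH, hf, hR, hadj⟩ := Nat.find_spec hP
  refine ⟨m, H, f, ⟨hH, ?_⟩, hf, hR, hadj⟩
  intro K hK
  by_contra hcon
  rw [not_nonempty_iff] at hcon
  let e := Fintype.equivFin K.verts
  let K' : SimpleGraph (Fin (Fintype.card K.verts)) := K.coe.comap e.symm
  have hcard : Fintype.card K.verts ≤ m := by
    simpa using Fintype.card_subtype_le (fun x => x ∈ K.verts)
  let g : Fin (Fintype.card K.verts) → Fin m := fun i => (e.symm i).1
  have hg : Function.Injective g := fun i j hij => e.symm.injective (Subtype.ext hij)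
  have hKe : Sym2.map g '' K'.edgeSet ⊆ K.edgeSet := by
    rintro _ ⟨x, hx, rfl⟩
    induction x using Sym2.ind with
    | _ i j => simpa [K', g] using hx
  have hKH : K.edgeSet ⊆ H.edgeSet := K.edgeSet_subset
  have h1 : K'.edgeSet.ncard ≤ K.edgeSet.ncard := by
    rw [← Set.ncard_image_of_injective K'.edgeSet (Sym2.map.injective hg)]
    exact Set.ncard_le_ncard hKe (Set.toFinite _)
  have h2 : K.edgeSet.ncard ≤ H.edgeSet.ncard := Set.ncard_le_ncard hKH (Set.toFinite _)
  have hlt : Fintype.card K.verts + K'.edgeSet.ncard < m + H.edgeSet.ncard := by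
    by_contra hge
    have e1 : Fintype.card K.verts = m := by omega
    have e2 : K.edgeSet.ncard = H.edgeSet.ncard := by omega
    apply hK
    have hv : K.verts = Set.univ := by
      apply Set.eq_of_subset_of_ncard_le (Set.subset_univ _) _ (Set.toFinite _)
      rw [Set.ncard_univ, Nat.card_eq_fintype_card, Fintype.card_fin,
        ← Nat.card_coe_set_eq, Nat.card_eq_fintype_card]
      omega
    have he : K.edgeSet = H.edgeSet :=
      Set.eq_of_subset_of_ncard_le hKH (by omega) (Set.toFinite _)
    ext x y
    · simp [hv]
    · rw [← Subgraph.mem_edgeSet, he]; simp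
  refine Nat.find_min hP (m := Fintype.card K.verts + K'.edgeSet.ncard) (by omega) ?_
  refine ⟨_, K', fun i => f (g i), rfl, ?_, hf.comp hg, fun i => hR _, ?_⟩
  · constructor
    intro ψ
    refine hcon.false ⟨fun x => ψ (e x), ?_⟩
    intro x y hxy
    apply ψ.map_rel
    simpa [K'] using hxy
  · intro i j hij
    apply hadj
    apply K.adj_sub
    simpa [K'] using hij

lemma crit_no_col {m : ℕ} {H : SimpleGraph (Fin m)} (hc : Critical52 H) (ψ : Fin m → Fin 5)
    (h : ∀ i j, H.Adj i j → c5 (ψ i) (ψ j)) : False :=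
  hc.1.false ⟨ψ, fun {i j} hij => h i j hij⟩

lemma crit_col {V : Type} {G : SimpleGraph V} (hc : Critical52 G) (S : Set V)
    (hS : S ≠ Set.univ) : ∃ φ, Col G S φ := by
  classical
  obtain ⟨ψ⟩ := hc.2 ((⊤ : G.Subgraph).induce S) (by
    intro h
    apply hS
    have := congrArg Subgraph.verts h
    simpa using this)
  refine ⟨fun x => if hx : x ∈ S then ψ ⟨x, hx⟩ else 0, ?_⟩
  intro x hx y hy hxy
  simp only [hx, hy, dite_true]
  apply ψ.map_rel
  simp [hx, hy, hxy]

lemma iso_edges {V W : Type} {G : SimpleGraph V} {H : SimpleGraph W} (e : G ≃g H) :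
    G.edgeSet.ncard = H.edgeSet.ncard := by
  rw [← Nat.card_coe_set_eq, ← Nat.card_coe_set_eq]
  exact Nat.card_congr e.mapEdgeSet

lemma smaller_cases {V : Type} [Fintype V] {G : SimpleGraph V} (h : SmallestCex G) {m : ℕ}
    {H : SimpleGraph (Fin m)} (hc : Critical52 H) (hm : m < Fintype.card V) :
    5 * (m : ℤ) - 4 * (H.edgeSet.ncard : ℤ) ≤ 1 ∨
    (m = 3 ∧ H.edgeSet.ncard = 3 ∧ ∀ x y, x ≠ y → H.Adj x y) ∨
    (m = 10 ∧ H.edgeSet.ncard = 12 ∧ ∃ E, GoodExc E ∧ Nonempty (H ≃g E)) := by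
  obtain ⟨_, _, _, _, _, hmin⟩ := h
  by_cases h3 : Nonempty (H ≃g cycleGraph 3)
  · obtain ⟨e⟩ := h3
    right; left
    refine ⟨by simpa using Fintype.card_congr e.toEquiv, by rw [iso_edges e, C3_edges], ?_⟩
    intro x y hxy
    rw [← e.map_adj_iff]
    exact C3_adj _ _ (fun hh => hxy (e.injective hh))
  by_cases h1 : Nonempty (H ≃g E1)
  · obtain ⟨e⟩ := h1
    right; right
    exact ⟨by simpa using Fintype.card_congr e.toEquiv, by rw [iso_edges e, E1_edges],
      E1, E1_good, ⟨e⟩⟩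
  by_cases h2 : Nonempty (H ≃g E2)
  · obtain ⟨e⟩ := h2
    right; right
    exact ⟨by simpa using Fintype.card_congr e.toEquiv, by rw [iso_edges e, E2_edges],
      E2, E2_good, ⟨e⟩⟩
  left
  have := hmin m H hc (not_nonempty_iff.1 h3) (not_nonempty_iff.1 h1) (not_nonempty_iff.1 h2) hm
  simpa [pot] using this

/-- Number of edges of `G` inside `S`. -/
noncomputable def iE {V : Type} (G : SimpleGraph V) (S : Set V) : ℕ :=
  {e | e ∈ G.edgeSet ∧ ∀ x ∈ e, x ∈ S}.ncard

/-- Potential of the subgraph induced by `S`. -/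
noncomputable def pS {V : Type} (G : SimpleGraph V) (S : Set V) : ℤ :=
  5 * (S.ncard : ℤ) - 4 * (iE G S : ℤ)

lemma iE_univ {V : Type} (G : SimpleGraph V) : iE G Set.univ = G.edgeSet.ncard := by
  simp [iE]

lemma pS_univ {V : Type} [Fintype V] (G : SimpleGraph V) : pS G Set.univ = pot G := by
  simp [pS, pot, iE_univ]

lemma iE_add {V : Type} [Fintype V] (G : SimpleGraph V) {S T : Set V} (hST : S ⊆ T)
    (B : Set (Sym2 V)) (hB : ∀ e ∈ B, e ∈ G.edgeSet ∧ (∀ x ∈ e, x ∈ T) ∧ ¬ ∀ x ∈ e, x ∈ S) :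
    iE G S + B.ncard ≤ iE G T := by
  unfold iE
  rw [← Set.ncard_union_eq _ (Set.toFinite _) (Set.toFinite _)]
  · apply Set.ncard_le_ncard _ (Set.toFinite _)
    rintro e (he | he)
    · exact ⟨he.1, fun x hx => hST (he.2 x hx)⟩
    · exact ⟨(hB e he).1, (hB e he).2.1⟩
  · rw [Set.disjoint_left]
    intro e he he'
    exact (hB e he').2.2 he.2

open Classical in
/-- The collapsing map sending `S` to the five-cycle. -/
noncomputable def coll {V : Type} (S : Set V) (φ : V → Fin 5) (x : V) : V ⊕ Fin 5 :=
  if x ∈ S then Sum.inr (φ x) else Sum.inl x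

/-- The graph obtained from `G` by collapsing `S` to a five-cycle. -/
noncomputable def collG {V : Type} (G : SimpleGraph V) (S : Set V) (φ : V → Fin 5) :
    SimpleGraph (V ⊕ Fin 5) where
  Adj p q := (∃ x y, G.Adj x y ∧ ¬ (x ∈ S ∧ y ∈ S) ∧ coll S φ x = p ∧ coll S φ y = q) ∨
    ∃ i j, c5 i j ∧ p = Sum.inr i ∧ q = Sum.inr j
  symm := by
    constructor
    rintro p q (⟨x, y, h, h', rfl, rfl⟩ | ⟨i, j, h, rfl, rfl⟩)
    · exact Or.inl ⟨y, x, h.symm, fun hh => h' hh.symm, rfl, rfl⟩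
    · exact Or.inr ⟨j, i, h.symm, rfl, rfl⟩
  loopless := by
    constructor
    rintro p (⟨x, y, h, h', h1, h2⟩ | ⟨i, j, h, h1, h2⟩)
    · have := h1.trans h2.symm
      unfold coll at this
      have hne := h.ne
      split_ifs at this with a b b
      · exact h' ⟨a, b⟩
      · exact hne (by simpa using this)
    · have := h1.symm.trans h2
      have hne := h.ne
      exact hne (by simpa using this)

lemma step {V : Type} [Fintype V] {G : SimpleGraph V} (hc : Critical52 G) (S : Set V)
    (hS : S ≠ Set.univ) (h6 : 6 ≤ S.ncard) :
    ∃ (m : ℕ) (H : SimpleGraph (Fin m)) (f : Fin m → V ⊕ Fin 5) (φ : V → Fin 5)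
      (A : Set V) (X : Finset (Fin 5)),
      Critical52 H ∧ Function.Injective f ∧ (∀ i j, H.Adj i j → (collG G S φ).Adj (f i) (f j)) ∧
      (∀ x, x ∈ A ↔ ∃ i, f i = Sum.inl x) ∧ (∀ k, k ∈ X ↔ ∃ i, f i = Sum.inr k) ∧
      (∀ x ∈ A, x ∉ S) ∧ A.Nonempty ∧ X.Nonempty ∧
      m = A.ncard + X.card ∧ m < Fintype.card V ∧
      H.edgeSet.ncard + iE G S ≤ iE G (S ∪ A) + (c5E X).card := by
  classical
  obtain ⟨φ, hφ⟩ := crit_col hc S hS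
  have hnc : ¬ ∃ ψ, Col (collG G S φ) {p | ∀ x, p = Sum.inl x → x ∉ S} ψ := by
    rintro ⟨ψ, hψ⟩
    refine hc.1.false ⟨fun x => ψ (coll S φ x), ?_⟩
    intro x y hxy
    apply hψ
    · intro z hz hzS
      unfold coll at hz
      split_ifs at hz with hx
      simp only [Sum.inl.injEq] at hz
      exact hx (hz ▸ hzS)
    · intro z hz hzS
      unfold coll at hz
      split_ifs at hz with hx
      simp only [Sum.inl.injEq] at hz
      exact hx (hz ▸ hzS)
    · by_cases hh : x ∈ S ∧ y ∈ S
      · right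
        exact ⟨φ x, φ y, hφ x hh.1 y hh.2 hxy, by simp [coll, hh.1], by simp [coll, hh.2]⟩
      · left
        exact ⟨x, y, hxy, hh, rfl, rfl⟩
  obtain ⟨m, H, f, hH, hf, hR, hadj⟩ := exists_critical _ _ hnc
  let A : Set V := {x | ∃ i, f i = Sum.inl x}
  let X : Finset (Fin 5) := Finset.univ.filter fun k => ∃ i, f i = Sum.inr k
  have hA : ∀ x, x ∈ A ↔ ∃ i, f i = Sum.inl x := fun x => Iff.rfl
  have hX : ∀ k, k ∈ X ↔ ∃ i, f i = Sum.inr k := fun k => by simp [X]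
  have hAS : ∀ x ∈ A, x ∉ S := by
    rintro x ⟨i, hi⟩
    exact hR i x hi
  have hm : m = A.ncard + X.card := by
    have h1 : (Set.range f).ncard = m := by
      rw [← Set.image_univ, Set.ncard_image_of_injective _ hf, Set.ncard_univ]; simp
    have h2 : Set.range f = Sum.inl '' A ∪ Sum.inr '' (X : Set (Fin 5)) := by
      ext p
      constructor
      · rintro ⟨i, rfl⟩
        rcases hi : f i with x | k
        · exact Or.inl ⟨x, ⟨i, hi⟩, rfl⟩
        · exact Or.inr ⟨k, (hX k).2 ⟨i, hi⟩, rfl⟩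
      · rintro (⟨x, ⟨i, hi⟩, rfl⟩ | ⟨k, hk, rfl⟩)
        · exact ⟨i, hi⟩
        · exact (hX k).1 hk
    rw [← h1, h2, Set.ncard_union_eq _ (Set.toFinite _) (Set.toFinite _),
      Set.ncard_image_of_injective _ Sum.inl_injective,
      Set.ncard_image_of_injective _ Sum.inr_injective, Set.ncard_coe_finset]
    rw [Set.disjoint_left]
    rintro _ ⟨x, _, rfl⟩ ⟨k, _, hk⟩
    cases hk
  refine ⟨m, H, f, φ, A, X, hH, hf, hadj, hA, hX, hAS, ?_, ?_, hm, ?_, ?_⟩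
  · by_contra hne
    rw [Set.not_nonempty_iff_eq_empty] at hne
    have hf2 : ∀ i, ∃ k, f i = Sum.inr k := by
      intro i
      rcases hi : f i with x | k
      · have : x ∈ A := ⟨i, hi⟩
        simp [hne] at this
      · exact ⟨k, rfl⟩
    choose ψ hψ using hf2
    apply crit_no_col hH ψ
    intro i j hij
    have := hadj i j hij
    rw [hψ i, hψ j] at this
    rcases this with ⟨x, y, h, h', h1, h2⟩ | ⟨i', j', h, h1, h2⟩
    · exfalso
      unfold coll at h1 h2
      split_ifs at h1 h2 with a b
      exact h' ⟨a, b⟩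
    · simp only [Sum.inr.injEq] at h1 h2
      rw [h1, h2]; exact h
  · by_contra hne
    rw [Finset.not_nonempty_iff_eq_empty] at hne
    have hf2 : ∀ i, ∃ x, f i = Sum.inl x := by
      intro i
      rcases hi : f i with x | k
      · exact ⟨x, rfl⟩
      · have : k ∈ X := (hX k).2 ⟨i, hi⟩
        simp [hne] at this
    choose g hg using hf2
    obtain ⟨ψ, hψ⟩ := crit_col hc Sᶜ (by
      intro h
      have : S = ∅ := by simpa using h
      simp [this] at h6)
    apply crit_no_col hH (fun i => ψ (g i))
    intro i j hij
    have := hadj i j hij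
    rw [hg i, hg j] at this
    rcases this with ⟨x, y, h, h', h1, h2⟩ | ⟨i', j', h, h1, h2⟩
    · unfold coll at h1 h2
      split_ifs at h1 h2 with a b
      simp only [Sum.inl.injEq] at h1 h2
      subst h1 h2
      exact hψ _ a _ b h
    · cases h1
  · have h1 : A.ncard ≤ Sᶜ.ncard := Set.ncard_le_ncard hAS (Set.toFinite _)
    have h2 : X.card ≤ 5 := by simpa using Finset.card_le_univ X
    have h3 := Set.ncard_add_ncard_compl S
    rw [Nat.card_eq_fintype_card] at h3
    omega
  · let B : Set (Sym2 V) := {e | e ∈ G.edgeSet ∧ (∀ x ∈ e, x ∈ S ∪ A) ∧ ¬ ∀ x ∈ e, x ∈ S}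
    have hB : iE G S + B.ncard ≤ iE G (S ∪ A) :=
      iE_add G Set.subset_union_left B (fun e he => he)
    have hsub : Sym2.map f '' H.edgeSet ⊆ (Sym2.map (coll S φ) '' B) ∪
        (Sym2.map Sum.inr '' (c5E X : Set (Sym2 (Fin 5)))) := by
      have hmem : ∀ x i, coll S φ x = f i → x ∈ S ∪ A := by
        intro x i hx
        by_cases hxS : x ∈ S
        · exact Or.inl hxS
        · right
          refine ⟨i, ?_⟩
          rw [← hx]; simp [coll, hxS]
      rintro _ ⟨e, he, rfl⟩
      induction e using Sym2.ind with
      | _ i j =>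
      rw [mem_edgeSet] at he
      rcases hadj i j he with ⟨x, y, h, h', h1, h2⟩ | ⟨i', j', h, h1, h2⟩
      · left
        refine ⟨s(x, y), ⟨h, ?_, ?_⟩, ?_⟩
        · intro z hz
          rcases Sym2.mem_iff.1 hz with rfl | rfl
          · exact hmem _ _ h1
          · exact hmem _ _ h2
        · intro hh
          exact h' ⟨hh x (by simp), hh y (by simp)⟩
        · simp [h1, h2]
      · right
        refine ⟨s(i', j'), ?_, ?_⟩
        · simp only [c5E, Finset.coe_filter, Set.mem_ofPred_eq, mem_edgeFinset, mem_edgeSet]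
          refine ⟨h, ?_⟩
          intro z hz
          rcases Sym2.mem_iff.1 hz with rfl | rfl
          · exact (hX _).2 ⟨_, h1⟩
          · exact (hX _).2 ⟨_, h2⟩
        · simp [h1, h2]
    have h1 := Set.ncard_le_ncard hsub (Set.toFinite _)
    rw [Set.ncard_image_of_injective _ (Sym2.map.injective hf)] at h1
    have h2 := Set.ncard_union_le (Sym2.map (coll S φ) '' B)
      (Sym2.map Sum.inr '' (c5E X : Set (Sym2 (Fin 5))))
    have h3 := Set.ncard_image_le (f := Sym2.map (coll S φ)) (Set.toFinite B)
    have h4 := Set.ncard_image_le (f := Sym2.map (Sum.inr : Fin 5 → V ⊕ Fin 5))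
      (Set.toFinite (c5E X : Set (Sym2 (Fin 5))))
    rw [Set.ncard_coe_finset] at h4
    omega

lemma pot1 {V : Type} [Fintype V] {G : SimpleGraph V} (h : SmallestCex G) :
    ∀ (n : ℕ) (S : Set V), Sᶜ.ncard = n → S ≠ Set.univ → 6 ≤ S.ncard → 4 ≤ pS G S := by
  intro n
  induction n using Nat.strong_induction_on with
  | _ n ih =>
  intro S hn hS h6
  by_contra hlt
  obtain ⟨m, H, f, φ, A, X, hH, hf, hadj, hA, hX, hAS, hAne, hXne, hm, hmV, hE⟩ :=
    step h.1 S hS h6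
  have hd : Disjoint S A := by
    rw [Set.disjoint_left]; intro x hx hx'; exact hAS x hx' hx
  have hcard : (S ∪ A).ncard = S.ncard + A.ncard :=
    Set.ncard_union_eq hd (Set.toFinite _) (Set.toFinite _)
  have hAp : 0 < A.ncard := (Set.ncard_pos (Set.toFinite _)).2 hAne
  have hX5 := (c5E_card X hXne).1
  have hpH : 5 * (m : ℤ) - 4 * (H.edgeSet.ncard : ℤ) ≤ 3 := by
    rcases smaller_cases h hH hmV with h1 | ⟨h1, h2, _⟩ | ⟨h1, h2, _⟩
    · omega
    · omega
    · omega
  have hp : pS G (S ∪ A) ≤ 1 := by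
    unfold pS at *
    rw [hcard]
    push_cast
    omega
  by_cases hu : S ∪ A = Set.univ
  · rw [hu, pS_univ] at hp
    have := h.2.2.2.2.1
    omega
  · have h3 := Set.ncard_add_ncard_compl S
    have h4 := Set.ncard_add_ncard_compl (S ∪ A)
    have := ih (S ∪ A)ᶜ.ncard (by omega) (S ∪ A) rfl hu (by omega)
    omega

lemma pot2 {V : Type} [Fintype V] {G : SimpleGraph V} (h : SmallestCex G) (S : Set V)
    (hS : S ≠ Set.univ) (h6 : 6 ≤ S.ncard) (hp4 : pS G S ≤ 4) :
    ∃ z1 z2, z1 ∉ S ∧ z2 ∉ S ∧ z1 ≠ z2 ∧ (∀ x, x ∈ S ∨ x = z1 ∨ x = z2) ∧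
      G.Adj z1 z2 ∧ (∃ x ∈ S, G.Adj z1 x) ∧ (∃ x ∈ S, G.Adj z2 x) := by
  obtain ⟨m, H, f, φ, A, X, hH, hf, hadj, hA, hX, hAS, hAne, hXne, hm, hmV, hE⟩ :=
    step h.1 S hS h6
  have hd : Disjoint S A := by
    rw [Set.disjoint_left]; intro x hx hx'; exact hAS x hx' hx
  have hcard : (S ∪ A).ncard = S.ncard + A.ncard :=
    Set.ncard_union_eq hd (Set.toFinite _) (Set.toFinite _)
  have hAp : 0 < A.ncard := (Set.ncard_pos (Set.toFinite _)).2 hAne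
  have hXp : 0 < X.card := Finset.card_pos.2 hXne
  obtain ⟨hX5, hX2⟩ := c5E_card X hXne
  have hp : pS G (S ∪ A) ≤ 5 * (m : ℤ) - 4 * (H.edgeSet.ncard : ℤ) - 1 -
      (5 * (X.card : ℤ) - 4 * ((c5E X).card : ℤ) - 5) := by
    unfold pS at *
    rw [hcard]
    push_cast
    omega
  have hp2 : 2 ≤ pS G (S ∪ A) := by
    by_cases hu : S ∪ A = Set.univ
    · rw [hu, pS_univ]
      exact h.2.2.2.2.1
    · have := pot1 h _ (S ∪ A) rfl hu (by omega)
      omega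
  rcases smaller_cases h hH hmV with h1 | ⟨h1, h2, hK⟩ | ⟨h1, h2, _⟩
  · omega
  · have hu : S ∪ A = Set.univ := by
      by_contra hu
      have := pot1 h _ (S ∪ A) rfl hu (by omega)
      omega
    have hX1 : X.card = 1 := by
      by_contra hne
      have h2 : X.card = 2 := by omega
      have := hX2 h2
      omega
    have hA2 : A.ncard = 2 := by omega
    obtain ⟨z1, z2, hz, hAz⟩ := Set.ncard_eq_two.1 hA2
    obtain ⟨k, hk⟩ := hXne
    have hz1 : z1 ∈ A := by simp [hAz]
    have hz2 : z2 ∈ A := by simp [hAz]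
    have hz1S := hAS _ hz1
    have hz2S := hAS _ hz2
    obtain ⟨i1, hi1⟩ := (hA _).1 hz1
    obtain ⟨i2, hi2⟩ := (hA _).1 hz2
    obtain ⟨i3, hi3⟩ := (hX _).1 hk
    have key : ∀ i z, f i = Sum.inl z → z ∉ S → ∃ x ∈ S, G.Adj z x := by
      intro i z hi hzS
      have hne : i ≠ i3 := by
        rintro rfl
        rw [hi] at hi3
        cases hi3
      rcases hadj _ _ (hK _ _ hne) with ⟨x, y, h, h', h1, h2⟩ | ⟨i', j', h, h1, h2⟩
      · rw [hi] at h1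
        rw [hi3] at h2
        unfold coll at h1 h2
        split_ifs at h1 h2 with a b
        simp only [Sum.inl.injEq] at h1
        subst h1
        exact ⟨y, b, h⟩
      · rw [hi] at h1; cases h1
    refine ⟨z1, z2, hz1S, hz2S, hz, ?_, ?_, key _ _ hi1 hz1S, key _ _ hi2 hz2S⟩
    · intro x
      have : x ∈ S ∪ A := by rw [hu]; trivial
      rcases this with h | h
      · exact Or.inl h
      · right; simpa [hAz] using h
    · have hne : i1 ≠ i2 := by
        rintro rfl
        rw [hi1] at hi2
        exact hz (by simpa using hi2)
      rcases hadj _ _ (hK _ _ hne) with ⟨x, y, h, h', h1, h2⟩ | ⟨i', j', h, h1, h2⟩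
      · rw [hi1] at h1
        rw [hi2] at h2
        unfold coll at h1 h2
        split_ifs at h1 h2 with a b
        simp only [Sum.inl.injEq] at h1 h2
        subst h1 h2
        exact h
      · rw [hi1] at h1; cases h1
  · omega

/-- The local configuration around a `(2,2,k)`-vertex. -/
structure Cfg {V : Type} (G : SimpleGraph V) (v a1 a2 u1 b1 b2 u2 c : V) : Prop where
  hv : ∀ x, G.Adj v x ↔ x = a1 ∨ x = b1 ∨ x = c
  ha1 : ∀ x, G.Adj a1 x ↔ x = v ∨ x = a2
  ha2 : ∀ x, G.Adj a2 x ↔ x = a1 ∨ x = u1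
  hb1 : ∀ x, G.Adj b1 x ↔ x = v ∨ x = b2
  hb2 : ∀ x, G.Adj b2 x ↔ x = b1 ∨ x = u2
  va : v ≠ a1 ∧ v ≠ a2 ∧ v ≠ b1 ∧ v ≠ b2
  aa : a1 ≠ a2 ∧ a1 ≠ b1 ∧ a1 ≠ b2 ∧ a2 ≠ b1 ∧ a2 ≠ b2 ∧ b1 ≠ b2
  n1 : u1 ≠ v ∧ u1 ≠ a1 ∧ u1 ≠ a2 ∧ u1 ≠ b1 ∧ u1 ≠ b2
  n2 : u2 ≠ v ∧ u2 ≠ a1 ∧ u2 ≠ a2 ∧ u2 ≠ b1 ∧ u2 ≠ b2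
  nc : c ≠ v ∧ c ≠ a1 ∧ c ≠ a2 ∧ c ≠ b1 ∧ c ≠ b2

lemma Cfg.swap {V : Type} {G : SimpleGraph V} {v a1 a2 u1 b1 b2 u2 c : V}
    (h : Cfg G v a1 a2 u1 b1 b2 u2 c) : Cfg G v b1 b2 u2 a1 a2 u1 c := by
  obtain ⟨hv, ha1, ha2, hb1, hb2, ⟨x1, x2, x3, x4⟩, ⟨y1, y2, y3, y4, y5, y6⟩,
    ⟨p1, p2, p3, p4, p5⟩, ⟨q1, q2, q3, q4, q5⟩, ⟨r1, r2, r3, r4, r5⟩⟩ := h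
  refine ⟨?_, hb1, hb2, ha1, ha2, ⟨x3, x4, x1, x2⟩,
    ⟨y6, y2.symm, y4.symm, y3.symm, y5.symm, y1⟩,
    ⟨q1, q4, q5, q2, q3⟩, ⟨p1, p4, p5, p2, p3⟩, ⟨r1, r4, r5, r2, r3⟩⟩
  intro x
  rw [hv]
  tauto

/-- The vertices outside the configuration. -/
def N0 {V : Type} (v a1 a2 b1 b2 : V) : Set V :=
  {x | x ≠ v ∧ x ≠ a1 ∧ x ≠ a2 ∧ x ≠ b1 ∧ x ≠ b2}

lemma Cfg.bad {V : Type} {G : SimpleGraph V} {v a1 a2 u1 b1 b2 u2 c : V}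
    (h : Cfg G v a1 a2 u1 b1 b2 u2 c) (hG : IsEmpty (G →g cycleGraph 5)) {φ : V → Fin 5}
    (hφ : Col G (N0 v a1 a2 b1 b2) φ) :
    c5 (φ u1) (φ c) ∧ c5 (φ u2) (φ c) ∧ φ u1 ≠ φ u2 := by
  classical
  apply c5_bad
  intro y hy
  by_contra hcon
  push Not at hcon
  obtain ⟨hy1, hy2⟩ := hcon
  obtain ⟨p1, q1, hp1, hpq1, hq1⟩ := c5_path3 _ _ hy1
  obtain ⟨p2, q2, hp2, hpq2, hq2⟩ := c5_path3 _ _ hy2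
  obtain ⟨hv, ha1, ha2, hb1, hb2, va, aa, n1, n2, nc⟩ := h
  let f : V → Fin 5 := fun x => if x = v then y else if x = a1 then p1 else if x = a2 then q1
    else if x = b1 then p2 else if x = b2 then q2 else φ x
  have fv : f v = y := by simp [f]
  have fa1 : f a1 = p1 := by simp [f, va.1.symm]
  have fa2 : f a2 = q1 := by simp [f, va.2.1.symm, aa.1.symm]
  have fb1 : f b1 = p2 := by simp [f, va.2.2.1.symm, aa.2.1.symm, aa.2.2.2.1.symm]
  have fb2 : f b2 = q2 := by
    simp [f, va.2.2.2.symm, aa.2.2.1.symm, aa.2.2.2.2.1.symm, aa.2.2.2.2.2.symm]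
  have fx : ∀ x, x ∈ N0 v a1 a2 b1 b2 → f x = φ x := by
    rintro x ⟨h1, h2, h3, h4, h5⟩
    simp [f, h1, h2, h3, h4, h5]
  have fu1 : f u1 = φ u1 := fx _ n1
  have fu2 : f u2 = φ u2 := fx _ n2
  have fc : f c = φ c := fx _ nc
  have key : ∀ x z, G.Adj x z → x ∉ N0 v a1 a2 b1 b2 → c5 (f x) (f z) := by
    intro x z hxz hx
    have hx' : x = v ∨ x = a1 ∨ x = a2 ∨ x = b1 ∨ x = b2 := by
      by_contra hh
      push Not at hh
      exact hx hh
    rcases hx' with rfl | rfl | rfl | rfl | rfl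
    · rcases (hv z).1 hxz with rfl | rfl | rfl
      · rw [fv, fa1]; exact hp1
      · rw [fv, fb1]; exact hp2
      · rw [fv, fc]; exact hy
    · rcases (ha1 z).1 hxz with rfl | rfl
      · rw [fv, fa1]; exact hp1.symm
      · rw [fa1, fa2]; exact hpq1
    · rcases (ha2 z).1 hxz with rfl | rfl
      · rw [fa1, fa2]; exact hpq1.symm
      · rw [fa2, fu1]; exact hq1
    · rcases (hb1 z).1 hxz with rfl | rfl
      · rw [fv, fb1]; exact hp2.symm
      · rw [fb1, fb2]; exact hpq2
    · rcases (hb2 z).1 hxz with rfl | rfl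
      · rw [fb1, fb2]; exact hpq2.symm
      · rw [fb2, fu2]; exact hq2
  refine hG.false ⟨f, ?_⟩
  intro x z hxz
  by_cases hx : x ∈ N0 v a1 a2 b1 b2
  · by_cases hz : z ∈ N0 v a1 a2 b1 b2
    · rw [fx x hx, fx z hz]; exact hφ x hx z hz hxz
    · exact (key z x hxz.symm hz).symm
  · exact key x z hxz hx

lemma iE_list {V : Type} [Fintype V] (G : SimpleGraph V) {S T : Set V} (hST : S ⊆ T)
    (L : List (Sym2 V)) (hL : L.Nodup)
    (hB : ∀ e ∈ L, e ∈ G.edgeSet ∧ (∀ x ∈ e, x ∈ T) ∧ ¬ ∀ x ∈ e, x ∈ S) :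
    iE G S + L.length ≤ iE G T := by
  classical
  have := iE_add G hST (L.toFinset : Set (Sym2 V)) (by
    intro e he
    exact hB e (by simpa using he))
  rwa [Set.ncard_coe_finset, List.toFinset_card_of_nodup hL] at this

/-- The reduced graph: `v` is joined to `u1` and `c` only. -/
def redG {V : Type} (G : SimpleGraph V) (v u1 c : V) (h1 : u1 ≠ v) (h2 : c ≠ v) :
    SimpleGraph V where
  Adj x y := (x ≠ v ∧ y ≠ v ∧ G.Adj x y) ∨ (x = v ∧ (y = u1 ∨ y = c)) ∨
    (y = v ∧ (x = u1 ∨ x = c))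
  symm := by
    constructor
    rintro x y (⟨p, q, r⟩ | h | h)
    · exact Or.inl ⟨q, p, r.symm⟩
    · exact Or.inr (Or.inr h)
    · exact Or.inr (Or.inl h)
  loopless := by
    constructor
    rintro x (⟨p, q, r⟩ | ⟨rfl, h | h⟩ | ⟨rfl, h | h⟩)
    · exact r.ne rfl
    · exact h1 h.symm
    · exact h2 h.symm
    · exact h1 h.symm
    · exact h2 h.symm

/-- The critical subgraph of the reduced graph, with its counting data. -/
lemma Cfg.red {V : Type} [Fintype V] {G : SimpleGraph V} {v a1 a2 u1 b1 b2 u2 c : V}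
    (h : Cfg G v a1 a2 u1 b1 b2 u2 c) (hG : Critical52 G) :
    ∃ (m : ℕ) (H : SimpleGraph (Fin m)) (g : Fin m → V) (w i1 i3 : Fin m) (T : Set V),
      Critical52 H ∧ Function.Injective g ∧ g w = v ∧ g i1 = u1 ∧ g i3 = c ∧ i1 ≠ i3 ∧
      H.Adj w i1 ∧ H.Adj w i3 ∧ (∀ i, H.Adj w i → i = i1 ∨ i = i3) ∧
      (∀ i j, i ≠ w → j ≠ w → H.Adj i j → G.Adj (g i) (g j)) ∧
      T ⊆ N0 v a1 a2 b1 b2 ∧ (∀ x, x ∈ T ↔ ∃ i, i ≠ w ∧ g i = x) ∧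
      m = T.ncard + 1 ∧ m < Fintype.card V ∧ H.edgeSet.ncard ≤ iE G T + 2 ∧
      (iE G T + 2 ≤ H.edgeSet.ncard → ∀ i j, i ≠ w → j ≠ w → G.Adj (g i) (g j) → H.Adj i j) := by
  classical
  have hu1v := h.n1.1
  have hcv := h.nc.1
  let R : Set V := {x | x ≠ a1 ∧ x ≠ a2 ∧ x ≠ b1 ∧ x ≠ b2}
  have hnc : ¬ ∃ ψ, Col (redG G v u1 c hu1v hcv) R ψ := by
    rintro ⟨ψ, hψ⟩
    have hcol : Col G (N0 v a1 a2 b1 b2) ψ := by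
      intro x hx y hy hxy
      exact hψ x hx.2 y hy.2 (Or.inl ⟨hx.1, hy.1, hxy⟩)
    have hb := (h.bad hG.1 hcol).1
    refine c5_path2 _ _ (ψ v) ?_ ?_ hb
    · exact hψ u1 h.n1.2 v h.va (Or.inr (Or.inr ⟨rfl, Or.inl rfl⟩))
    · exact hψ v h.va c h.nc.2 (Or.inr (Or.inl ⟨rfl, Or.inr rfl⟩))
  obtain ⟨m, H, g, hH, hg, hR, hadj⟩ := exists_critical _ _ hnc
  obtain ⟨φ, hφ⟩ := crit_col hG (N0 v a1 a2 b1 b2) (by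
    intro hh
    have : v ∈ N0 v a1 a2 b1 b2 := by rw [hh]; trivial
    exact this.1 rfl)
  have huc : u1 ≠ c := by
    intro hh
    have := (h.bad hG.1 hφ).1
    rw [hh] at this
    exact this.ne rfl
  have key : ∀ s, s ≠ v → ¬ ∀ i j, H.Adj i j → g i = v → g j = s := by
    intro s hs hall
    obtain ⟨y, hy⟩ := c5_ex (φ s)
    apply crit_no_col hH (fun i => if g i = v then y else φ (g i))
    intro i j hij
    by_cases hi : g i = v
    · have hj := hall i j hij hi
      simp only [hi, hj, hs, if_true, if_false]
      exact hy.symm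
    · by_cases hj : g j = v
      · have hi' := hall j i hij.symm hj
        simp only [hj, hi', hs, if_true, if_false]
        exact hy
      · simp only [hi, hj, if_false]
        rcases hadj i j hij with ⟨_, _, h3⟩ | ⟨h1, _⟩ | ⟨h1, _⟩
        · exact hφ _ ⟨hi, hR i⟩ _ ⟨hj, hR j⟩ h3
        · exact absurd h1 hi
        · exact absurd h1 hj
  have vadj : ∀ i j, H.Adj i j → g i = v → g j = u1 ∨ g j = c := by
    intro i j hij hi
    rcases hadj i j hij with ⟨h1, _⟩ | ⟨_, h2⟩ | ⟨h1, h2⟩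
    · exact absurd hi h1
    · exact h2
    · rcases h2 with h2 | h2
      · exact absurd (h2.symm.trans hi) hu1v
      · exact absurd (h2.symm.trans hi) hcv
  have e1 : ∃ i j, H.Adj i j ∧ g i = v ∧ g j = u1 := by
    by_contra hcon
    push Not at hcon
    exact key c hcv fun i j hij hi => (vadj i j hij hi).resolve_left (hcon i j hij hi)
  have e3 : ∃ i j, H.Adj i j ∧ g i = v ∧ g j = c := by
    by_contra hcon
    push Not at hcon
    exact key u1 hu1v fun i j hij hi => (vadj i j hij hi).resolve_right (hcon i j hij hi)
  obtain ⟨w, i1, hw1, hw, hi1⟩ := e1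
  obtain ⟨w', i3, hw3, hw', hi3⟩ := e3
  have : w' = w := hg (hw'.trans hw.symm)
  subst this
  have gne : ∀ i, i ≠ w' → g i ≠ v := fun i hi hh => hi (hg (hh.trans hw.symm))
  let T : Set V := g '' {i | i ≠ w'}
  have hT : ∀ x, x ∈ T ↔ ∃ i, i ≠ w' ∧ g i = x := fun x => Iff.rfl
  have hTc : m = T.ncard + 1 := by
    have h1 : T.ncard = ({w'}ᶜ : Set (Fin m)).ncard := Set.ncard_image_of_injective _ hg
    have h2 := Set.ncard_add_ncard_compl ({w'} : Set (Fin m))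
    rw [Set.ncard_singleton, Nat.card_eq_fintype_card, Fintype.card_fin] at h2
    omega
  have hmV : m < Fintype.card V := by
    have := Fintype.card_lt_of_injective_of_notMem g hg (b := a1) (by
      rintro ⟨i, hi⟩
      exact (hR i).1 hi)
    simpa using this
  let I : Set (Sym2 V) := {e | e ∈ G.edgeSet ∧ ∀ x ∈ e, x ∈ T}
  let Q : Set (Sym2 V) := {s(v, u1), s(v, c)}
  have hQ : Q.ncard ≤ 2 := (Set.ncard_insert_le _ _).trans (by simp)
  have hI : I.ncard = iE G T := rfl
  have himg : Sym2.map g '' H.edgeSet ⊆ I ∪ Q := by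
    rintro _ ⟨e, he, rfl⟩
    induction e using Sym2.ind with
    | _ i j =>
    rw [mem_edgeSet] at he
    rw [Sym2.map_mk]
    by_cases hi : i = w'
    · right
      subst hi
      rcases vadj _ _ he hw with h1 | h1 <;> simp [Q, h1, hw]
    · by_cases hj : j = w'
      · right
        subst hj
        rcases vadj _ _ he.symm hw with h1 | h1 <;> simp [Q, h1, hw]
      · left
        rcases hadj i j he with ⟨_, _, h3⟩ | ⟨h1, _⟩ | ⟨h1, _⟩
        · refine ⟨h3, ?_⟩
          intro x hx
          rcases Sym2.mem_iff.1 hx with rfl | rfl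
          · exact ⟨i, hi, rfl⟩
          · exact ⟨j, hj, rfl⟩
        · exact absurd h1 (gne i hi)
        · exact absurd h1 (gne j hj)
  have hcardI : (Sym2.map g '' H.edgeSet).ncard = H.edgeSet.ncard :=
    Set.ncard_image_of_injective _ (Sym2.map.injective hg)
  have hU := Set.ncard_union_le I Q
  refine ⟨m, H, g, w', i1, i3, T, hH, hg, hw, hi1, hi3, ?_, hw1, hw3, ?_, ?_, ?_, hT, hTc, hmV,
    ?_, ?_⟩
  · rintro rfl
    exact huc (hi1.symm.trans hi3)
  · intro i hi
    rcases vadj _ _ hi hw with h1 | h1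
    · exact Or.inl (hg (h1.trans hi1.symm))
    · exact Or.inr (hg (h1.trans hi3.symm))
  · intro i j hi hj hij
    rcases hadj i j hij with ⟨_, _, h3⟩ | ⟨h1, _⟩ | ⟨h1, _⟩
    · exact h3
    · exact absurd h1 (gne i hi)
    · exact absurd h1 (gne j hj)
  · rintro _ ⟨i, hi, rfl⟩
    exact ⟨gne i hi, hR i⟩
  · have := Set.ncard_le_ncard himg (Set.toFinite _)
    omega
  · intro hle i j hi hj hij
    have heq : Sym2.map g '' H.edgeSet = I ∪ Q :=
      Set.eq_of_subset_of_ncard_le himg (by omega) (Set.toFinite _)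
    have hmem : s(g i, g j) ∈ I ∪ Q := by
      left
      refine ⟨hij, ?_⟩
      intro x hx
      rcases Sym2.mem_iff.1 hx with rfl | rfl
      · exact ⟨i, hi, rfl⟩
      · exact ⟨j, hj, rfl⟩
    rw [← heq] at hmem
    obtain ⟨e, he, hee⟩ := hmem
    rw [← Sym2.map_mk] at hee
    have := Sym2.map.injective hg hee
    subst this
    exact he

lemma Cfg.adj {V : Type} [Fintype V] {G : SimpleGraph V} {v a1 a2 u1 b1 b2 u2 c : V}
    (h : Cfg G v a1 a2 u1 b1 b2 u2 c) (hG : SmallestCex G) : G.Adj u1 c := by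
  classical
  obtain ⟨m, H, g, w, i1, i3, T, hH, hg, hw, hi1, hi3, h13, hw1, hw3, hdeg, hadj, hTN, hT, hm,
    hmV, hE, hEq⟩ := h.red hG.1
  have hbad := fun φ hφ => h.bad hG.1.1 (φ := φ) hφ
  obtain ⟨hv, ha1, ha2, hb1, hb2, va, aa, n1, n2, nc⟩ := h
  have hiw1 : i1 ≠ w := hw1.ne.symm
  have hiw3 : i3 ≠ w := hw3.ne.symm
  have hu1T : u1 ∈ T := (hT _).2 ⟨i1, hiw1, hi1⟩
  have hcT : c ∈ T := (hT _).2 ⟨i3, hiw3, hi3⟩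
  have hvT : v ∉ T := fun hh => (hTN hh).1 rfl
  have ha1T : a1 ∉ T := fun hh => (hTN hh).2.1 rfl
  have ha2T : a2 ∉ T := fun hh => (hTN hh).2.2.1 rfl
  have hb1T : b1 ∉ T := fun hh => (hTN hh).2.2.2.1 rfl
  have hb2T : b2 ∉ T := fun hh => (hTN hh).2.2.2.2 rfl
  have huc : u1 ≠ c := by
    rintro hh
    exact h13 (hg (hi1.trans (hh.trans hi3.symm)))
  have hT2 : 2 ≤ T.ncard := by
    rw [← Set.ncard_pair huc]
    apply Set.ncard_le_ncard _ (Set.toFinite _)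
    rintro x (rfl | rfl)
    · exact hu1T
    · exact hcT
  -- the first extension
  have hS3 : (T ∪ {v, a1, a2}).ncard = T.ncard + 3 := by
    rw [Set.ncard_union_eq _ (Set.toFinite _) (Set.toFinite _)]
    · congr 1
      exact Set.ncard_eq_three.2 ⟨v, a1, a2, va.1, va.2.1, aa.1, rfl⟩
    · rw [Set.disjoint_left]
      rintro x hx (rfl | rfl | rfl) <;> contradiction
  have hiS3 : iE G T + 4 ≤ iE G (T ∪ {v, a1, a2}) := by
    refine iE_list G Set.subset_union_left [s(v, c), s(v, a1), s(a1, a2), s(a2, u1)] ?_ ?_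
    · simp
      grind
    · intro e he
      simp only [List.mem_cons, List.not_mem_nil, or_false] at he
      rcases he with rfl | rfl | rfl | rfl <;>
        simp [hv, ha1, ha2, hvT, ha1T, ha2T, hu1T, hcT]
  -- the second extension
  have hS5 : (T ∪ {v, a1, a2, b1, b2}).ncard = T.ncard + 5 := by
    rw [Set.ncard_union_eq _ (Set.toFinite _) (Set.toFinite _)]
    · congr 1
      have : ({v, a1, a2, b1, b2} : Set V) = (({v, a1, a2, b1, b2} : Finset V) : Set V) := by simp
      rw [this, Set.ncard_coe_finset]
      rw [Finset.card_insert_of_notMem, Finset.card_insert_of_notMem,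
        Finset.card_insert_of_notMem, Finset.card_insert_of_notMem, Finset.card_singleton] <;>
        simp <;> grind
    · rw [Set.disjoint_left]
      rintro x hx (rfl | rfl | rfl | rfl | rfl) <;> contradiction
  have hiS5 : u2 ∈ T → iE G T + 7 ≤ iE G (T ∪ {v, a1, a2, b1, b2}) := by
    intro hu2T
    refine iE_list G Set.subset_union_left
      [s(v, c), s(v, a1), s(a1, a2), s(a2, u1), s(v, b1), s(b1, b2), s(b2, u2)] ?_ ?_
    · simp
      grind
    · intro e he
      simp only [List.mem_cons, List.not_mem_nil, or_false] at he
      rcases he with rfl | rfl | rfl | rfl | rfl | rfl | rfl <;>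
        simp [hv, ha1, ha2, hb1, hb2, hvT, ha1T, ha2T, hb1T, hb2T, hu1T, hcT, hu2T]
  have hpot : 2 ≤ pot G := hG.2.2.2.2.1
  have hne3 : T ∪ {v, a1, a2} ≠ Set.univ := by
    intro hh
    have : b1 ∈ T ∪ {v, a1, a2} := by rw [hh]; trivial
    rcases this with h1 | h1 | h1 | h1
    · exact hb1T h1
    · exact va.2.2.1 h1.symm
    · exact aa.2.1 h1.symm
    · exact aa.2.2.2.1 h1.symm
  rcases smaller_cases hG hH hmV with h1 | ⟨h1, h2, hK⟩ | ⟨h1, h2, E, hEgood, ⟨e⟩⟩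
  · exfalso
    have hm4 : m ≠ 3 := by
      intro hm3
      have hc2 : H.edgeSet.ncard ≤ m.choose 2 := by
        rw [ncard_edgeSet_eq]
        simpa using H.card_edgeFinset_le_card_choose_two
      have : m.choose 2 = 3 := by rw [hm3]; rfl
      omega
    by_cases hu2T : u2 ∈ T
    · have hi := hiS5 hu2T
      have hp : pS G (T ∪ {v, a1, a2, b1, b2}) ≤ 1 := by
        unfold pS
        omega
      by_cases hu : T ∪ {v, a1, a2, b1, b2} = Set.univ
      · rw [hu, pS_univ] at hp
        omega
      · have := pot1 hG _ _ rfl hu (by omega)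
        omega
    · have hp : pS G (T ∪ {v, a1, a2}) ≤ 3 := by
        unfold pS
        omega
      have := pot1 hG _ _ rfl hne3 (by omega)
      omega
  · rw [← hi1, ← hi3]
    exact hadj _ _ hiw1 hiw3 (hK _ _ h13)
  · exfalso
    by_cases hu2T : u2 ∈ T
    · have hi := hiS5 hu2T
      have hp : pS G (T ∪ {v, a1, a2, b1, b2}) ≤ 2 := by
        unfold pS
        omega
      have hu : T ∪ {v, a1, a2, b1, b2} = Set.univ := by
        by_contra hu
        have := pot1 hG _ _ rfl hu (by omega)
        omega
      have hp2 : 2 ≤ pS G (T ∪ {v, a1, a2, b1, b2}) := by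
        rw [hu, pS_univ]; exact hpot
      have hEE : iE G T + 2 ≤ H.edgeSet.ncard := by
        unfold pS at hp2
        omega
      have hback := hEq hEE
      obtain ⟨i2, hi2w, hi2⟩ := (hT _).1 hu2T
      obtain ⟨ψ, hψ, hψbad⟩ := hEgood (e w) (e i1) (e.map_adj_iff.2 hw1) (e i3)
        (e.map_adj_iff.2 hw3) (fun hh => h13 (e.injective hh)) (by
          intro x hx
          obtain ⟨j, rfl⟩ := e.surjective x
          rcases hdeg j (e.map_adj_iff.1 hx) with rfl | rfl
          · exact Or.inl rfl
          · exact Or.inr rfl) (e i2) (fun hh => hi2w (e.injective hh))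
      let φ : V → Fin 5 := fun x => if hx : ∃ i, g i = x then ψ (e hx.choose) else 0
      have hφg : ∀ i, φ (g i) = ψ (e i) := by
        intro i
        have hx : ∃ j, g j = g i := ⟨i, rfl⟩
        have : hx.choose = i := hg hx.choose_spec
        simp only [φ]
        rw [dif_pos hx, this]
      have hcol : Col G (N0 v a1 a2 b1 b2) φ := by
        have hin : ∀ x ∈ N0 v a1 a2 b1 b2, ∃ i, i ≠ w ∧ g i = x := by
          intro x hx
          apply (hT x).1
          have hxu : x ∈ T ∪ {v, a1, a2, b1, b2} := by rw [hu]; trivial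
          obtain ⟨q1, q2, q3, q4, q5⟩ := hx
          rcases hxu with hh | hh | hh | hh | hh | hh
          · exact hh
          all_goals exact absurd hh (by assumption)
        intro x hx y hy hxy
        obtain ⟨i, hiw, rfl⟩ := hin x hx
        obtain ⟨j, hjw, rfl⟩ := hin y hy
        rw [hφg, hφg]
        apply hψ _ _ (fun hh => hiw (e.injective hh)) (fun hh => hjw (e.injective hh))
        exact e.map_adj_iff.2 (hback i j hiw hjw hxy)
      have := hbad φ hcol
      rw [← hi1, ← hi2, ← hi3, hφg, hφg, hφg] at this
      exact hψbad this
    · have hp : pS G (T ∪ {v, a1, a2}) ≤ 4 := by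
        unfold pS
        omega
      obtain ⟨z1, z2, hz1, hz2, hz, hall, -⟩ := pot2 hG _ hne3 (by omega) hp
      have k1 : b1 ∉ T ∪ {v, a1, a2} := by
        simp [hb1T, va.2.2.1.symm, aa.2.1.symm, aa.2.2.2.1.symm]
      have k2 : b2 ∉ T ∪ {v, a1, a2} := by
        simp [hb2T, va.2.2.2.symm, aa.2.2.1.symm, aa.2.2.2.2.1.symm]
      have k3 : u2 ∉ T ∪ {v, a1, a2} := by
        simp [hu2T, n2]
      have l1 := (hall b1).resolve_left k1
      have l2 := (hall b2).resolve_left k2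
      have l3 := (hall u2).resolve_left k3
      have m1 := aa.2.2.2.2.2
      have m2 := n2.2.2.2.1
      have m3 := n2.2.2.2.2
      grind

lemma iso_E1 {V : Type} [Fintype V] {G : SimpleGraph V} (f : Fin 10 → V)
    (hf : Function.Injective f) (hV : Fintype.card V = 10) (he : G.edgeSet.ncard ≤ 12)
    (hom : ∀ i j, E1.Adj i j → G.Adj (f i) (f j)) : Nonempty (G ≃g E1) := by
  classical
  have hbij : Function.Bijective f :=
    (Fintype.bijective_iff_injective_and_card f).2 ⟨hf, by simp [hV]⟩
  have hsub : Sym2.map f '' E1.edgeSet ⊆ G.edgeSet := by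
    rintro _ ⟨e, he, rfl⟩
    induction e using Sym2.ind with
    | _ i j => exact hom i j he
  have heq : Sym2.map f '' E1.edgeSet = G.edgeSet := by
    apply Set.eq_of_subset_of_ncard_le hsub _ (Set.toFinite _)
    rw [Set.ncard_image_of_injective _ (Sym2.map.injective hf), E1_edges]
    exact he
  refine ⟨RelIso.symm ⟨Equiv.ofBijective f hbij, ?_⟩⟩
  intro i j
  constructor
  · intro hij
    have hmem : s(f i, f j) ∈ G.edgeSet := hij
    rw [← heq] at hmem
    obtain ⟨e, he, hee⟩ := hmem
    rw [← Sym2.map_mk] at hee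
    have := Sym2.map.injective hf hee
    subst this
    exact he
  · intro hij
    exact hom i j hij

lemma Cfg.outer {V : Type} [Fintype V] {G : SimpleGraph V} {v a1 a2 u1 b1 b2 u2 c : V}
    (h : Cfg G v a1 a2 u1 b1 b2 u2 c) (hd : 3 ≤ deg G u1) (h12 : u1 ≠ u2) (h1c : u1 ≠ c)
    (hn : ¬ G.Adj u1 u2) :
    ∃ x, G.Adj u1 x ∧ x ∉ ({v, a1, a2, u1, b1, b2, u2, c} : Set V) := by
  by_contra hcon
  push Not at hcon
  obtain ⟨hv, ha1, ha2, hb1, hb2, va, aa, n1, n2, nc⟩ := h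
  have hsub : G.neighborSet u1 ⊆ {a2, c} := by
    intro x hx
    have hx' : G.Adj u1 x := hx
    rcases hcon x hx with rfl | rfl | rfl | rfl | rfl | rfl | rfl | rfl
    · have := (hv _).1 hx'.symm; grind
    · have := (ha1 _).1 hx'.symm; grind
    · simp
    · exact absurd rfl hx'.ne
    · have := (hb1 _).1 hx'.symm; grind
    · have := (hb2 _).1 hx'.symm; grind
    · exact absurd hx' hn
    · simp
  have h1 := Set.ncard_le_ncard hsub (Set.toFinite _)
  have h2 : ({a2, c} : Set V).ncard ≤ 2 := (Set.ncard_insert_le _ _).trans (by simp)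
  unfold deg at hd
  omega

lemma ncard_list {V : Type} (L : List V) (hL : L.Nodup) : {x | x ∈ L}.ncard = L.length := by
  classical
  have : {x | x ∈ L} = (L.toFinset : Set V) := by ext; simp
  rw [this, Set.ncard_coe_finset, List.toFinset_card_of_nodup hL]

lemma Cfg.false {V : Type} [Fintype V] {G : SimpleGraph V} {v a1 a2 u1 b1 b2 u2 c : V}
    (h : Cfg G v a1 a2 u1 b1 b2 u2 c) (hG : SmallestCex G) (hd1 : 3 ≤ deg G u1)
    (hd2 : 3 ≤ deg G u2) : False := by
  classical
  have hu1c := h.adj hG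
  have hu2c := h.swap.adj hG
  obtain ⟨φ, hφ⟩ := crit_col hG.1 (N0 v a1 a2 b1 b2) (by
    intro hh
    have : v ∈ N0 v a1 a2 b1 b2 := by rw [hh]; trivial
    exact this.1 rfl)
  have hb := h.bad hG.1.1 hφ
  have h12 : u1 ≠ u2 := fun hh => hb.2.2 (by rw [hh])
  have hn : ¬ G.Adj u1 u2 := fun hh =>
    c5_notri _ _ _ (hφ _ h.n1 _ h.n2 hh) hb.2.1 hb.1
  obtain ⟨x1, hx1, hx1S⟩ := h.outer hd1 h12 hu1c.ne hn
  obtain ⟨x2, hx2, hx2S⟩ := h.swap.outer hd2 h12.symm hu2c.ne (fun hh => hn hh.symm)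
  obtain ⟨hv, ha1, ha2, hb1, hb2, ⟨va1, va2, vb1, vb2⟩, ⟨a12, a1b1, a1b2, a2b1, a2b2, b12⟩,
    ⟨p1, p2, p3, p4, p5⟩, ⟨q1, q2, q3, q4, q5⟩, ⟨r1, r2, r3, r4, r5⟩⟩ := h
  have h1c := hu1c.ne
  have h2c := hu2c.ne
  let S : Set V := {v, a1, a2, u1, b1, b2, u2, c}
  have hx2S' : x2 ∉ S := by
    simp only [S, Set.mem_insert_iff, Set.mem_singleton_iff] at hx2S ⊢
    tauto
  have hx1S' : x1 ∉ S := hx1S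
  have hnod : [v, a1, a2, u1, b1, b2, u2, c].Nodup := by
    simp
    grind
  have hScard : S.ncard = 8 := by
    have hSe : S = {x | x ∈ [v, a1, a2, u1, b1, b2, u2, c]} := by ext x; simp [S]
    rw [hSe, ncard_list _ hnod]
    rfl
  have nine : ∀ e ∈ [s(v, c), s(v, a1), s(a1, a2), s(a2, u1), s(v, b1), s(b1, b2), s(b2, u2),
      s(u1, c), s(u2, c)], e ∈ G.edgeSet ∧ (∀ x ∈ e, x ∈ S) := by
    intro e he
    simp only [List.mem_cons, List.not_mem_nil, or_false] at he
    rcases he with rfl | rfl | rfl | rfl | rfl | rfl | rfl | rfl | rfl <;>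
      simp [hv, ha1, ha2, hb1, hb2, hu1c, hu2c, S]
  have ninod : [s(v, c), s(v, a1), s(a1, a2), s(a2, u1), s(v, b1), s(b1, b2), s(b2, u2),
      s(u1, c), s(u2, c)].Nodup := by
    simp
    grind
  have hiS : 9 ≤ iE G S := by
    have := iE_list G (Set.empty_subset S) _ ninod (by
      intro e he
      refine ⟨(nine e he).1, (nine e he).2, ?_⟩
      intro hh
      induction e using Sym2.ind with
      | _ x y => exact hh x (by simp))
    simp only [List.length_cons, List.length_nil] at this
    omega
  have hSne : S ≠ Set.univ := by
    intro hh
    apply hx1S'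
    rw [hh]; trivial
  obtain ⟨z1, z2, hz1, hz2, hz, hall, hz12, hz1n, hz2n⟩ := pot2 hG S hSne (by omega) (by
    unfold pS
    omega)
  have hV : Fintype.card V = 10 := by
    have huniv : S ∪ {z1, z2} = Set.univ := by
      ext x
      have := hall x
      simp only [Set.mem_union, Set.mem_insert_iff, Set.mem_singleton_iff, Set.mem_univ, iff_true]
      exact this
    have h1 : (S ∪ {z1, z2}).ncard = 10 := by
      rw [Set.ncard_union_eq _ (Set.toFinite _) (Set.toFinite _), hScard, Set.ncard_pair hz]
      rw [Set.disjoint_left]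
      rintro x hx (rfl | rfl) <;> contradiction
    rw [huniv, Set.ncard_univ, Nat.card_eq_fintype_card] at h1
    exact h1
  have he12 : G.edgeSet.ncard ≤ 12 := by
    have hpot : 2 ≤ pot G := hG.2.2.2.2.1
    unfold pot at hpot
    omega
  -- choose names so that `u1` is adjacent to `z`
  obtain ⟨z, z', hzS, hz'S, hzz, hzadj, hu1z, hx2z, y, hyS, hyz⟩ : ∃ z z', z ∉ S ∧ z' ∉ S ∧ z ≠ z' ∧
      G.Adj z z' ∧ G.Adj u1 z ∧ (x2 = z ∨ x2 = z') ∧ ∃ y ∈ S, G.Adj z' y := by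
    rcases (hall x1).resolve_left hx1S' with rfl | rfl
    · exact ⟨x1, z2, hz1, hz2, hz, hz12, hx1, (hall x2).resolve_left hx2S', hz2n⟩
    · exact ⟨x1, z1, hz2, hz1, hz.symm, hz12.symm, hx1, ((hall x2).resolve_left hx2S').symm, hz1n⟩
  have hu1S : u1 ∈ S := by simp [S]
  have hu2S : u2 ∈ S := by simp [S]
  have hx2z' : x2 = z' := by
    rcases hx2z with rfl | hh
    · exfalso
      have := iE_list G (Set.subset_univ S) [s(u1, x2), s(u2, x2), s(x2, z'), s(z', y)] (by
        have : u1 ≠ x2 := fun hh => hzS (hh ▸ hu1S)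
        have : u2 ≠ x2 := fun hh => hzS (hh ▸ hu2S)
        have : u1 ≠ z' := fun hh => hz'S (hh ▸ hu1S)
        have : u2 ≠ z' := fun hh => hz'S (hh ▸ hu2S)
        have : y ≠ x2 := fun hh => hzS (hh ▸ hyS)
        simp
        grind) (by
        intro e he
        simp only [List.mem_cons, List.not_mem_nil, or_false] at he
        rcases he with rfl | rfl | rfl | rfl
        · exact ⟨hu1z, by simp, fun hh => hzS (hh x2 (by simp))⟩
        · exact ⟨hx2, by simp, fun hh => hzS (hh x2 (by simp))⟩
        · exact ⟨hzadj, by simp, fun hh => hzS (hh x2 (by simp))⟩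
        · exact ⟨hyz, by simp, fun hh => hz'S (hh z' (by simp))⟩)
      simp only [List.length_cons, List.length_nil, iE_univ] at this
      omega
    · exact hh
  subst hx2z'
  obtain ⟨e⟩ := iso_E1 (G := G) ![v, a1, a2, u1, z, x2, u2, b2, b1, c] (by
    have hnod2 : [v, a1, a2, u1, z, x2, u2, b2, b1, c].Nodup := by
      simp only [S, Set.mem_insert_iff, Set.mem_singleton_iff, not_or] at hzS hz'S
      simp
      grind
    have := List.nodup_iff_injective_get.1 hnod2
    intro i j hij
    apply this
    fin_cases i <;> fin_cases j <;> exact hij) hV he12 (by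
    have hvc : G.Adj v c := (hv c).2 (by simp)
    have hva : G.Adj v a1 := (hv a1).2 (by simp)
    have hvb : G.Adj v b1 := (hv b1).2 (by simp)
    have haa : G.Adj a1 a2 := (ha1 a2).2 (by simp)
    have hbb : G.Adj b1 b2 := (hb1 b2).2 (by simp)
    have hau : G.Adj a2 u1 := (ha2 u1).2 (by simp)
    have hbu : G.Adj b2 u2 := (hb2 u2).2 (by simp)
    intro i j hij
    have hij' := hij
    simp only [E1, fromEdgeSet_adj, Set.mem_insert_iff, Set.mem_singleton_iff, Sym2.eq_iff] at hij'
    obtain ⟨hc, -⟩ := hij'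
    rcases hc with hc | hc | hc | hc | hc | hc | hc | hc | hc | hc | hc | hc <;>
      rcases hc with ⟨rfl, rfl⟩ | ⟨rfl, rfl⟩ <;>
      first
        | assumption
        | (apply SimpleGraph.Adj.symm; assumption))
  exact hG.2.2.1.false e

lemma deg_two {V : Type} [Fintype V] {G : SimpleGraph V} {x p q : V} (hd : deg G x = 2)
    (hp : G.Adj x p) (hq : G.Adj x q) (hpq : p ≠ q) : ∀ y, G.Adj x y ↔ y = p ∨ y = q := by
  have hsub : ({p, q} : Set V) ⊆ G.neighborSet x := by
    rintro y (rfl | rfl)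
    · exact hp
    · exact hq
  have heq := Set.eq_of_subset_of_ncard_le hsub (by
    rw [Set.ncard_pair hpq]; exact hd.le) (Set.toFinite _)
  intro y
  rw [← mem_neighborSet, ← heq]
  simp

lemma deg_three {V : Type} [Fintype V] {G : SimpleGraph V} {x p q r : V} (hd : deg G x = 3)
    (hp : G.Adj x p) (hq : G.Adj x q) (hr : G.Adj x r) (hpq : p ≠ q) (hpr : p ≠ r)
    (hqr : q ≠ r) : ∀ y, G.Adj x y ↔ y = p ∨ y = q ∨ y = r := by
  have hsub : ({p, q, r} : Set V) ⊆ G.neighborSet x := by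
    rintro y (rfl | rfl | rfl)
    · exact hp
    · exact hq
    · exact hr
  have heq := Set.eq_of_subset_of_ncard_le hsub (by
    rw [Set.ncard_eq_three.2 ⟨p, q, r, hpq, hpr, hqr, rfl⟩]; exact hd.le) (Set.toFinite _)
  intro y
  rw [← mem_neighborSet, ← heq]
  simp

lemma string3 {V : Type} [Fintype V] {G : SimpleGraph V} {v u : V} (p : G.Walk v u)
    (hs : IsString G p) (hl : p.length = 3) :
    ∃ a2, G.Adj v (p.getVert 1) ∧ v ≠ p.getVert 1 ∧ v ≠ a2 ∧ v ≠ u ∧ p.getVert 1 ≠ a2 ∧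
      p.getVert 1 ≠ u ∧ a2 ≠ u ∧
      (∀ x, G.Adj (p.getVert 1) x ↔ x = v ∨ x = a2) ∧
      (∀ x, G.Adj a2 x ↔ x = p.getVert 1 ∨ x = u) ∧
      deg G (p.getVert 1) = 2 ∧ deg G a2 = 2 := by
  obtain ⟨hp, -, -, -, hdeg⟩ := hs
  have inj : ∀ i j, i ≤ 3 → j ≤ 3 → i ≠ j → p.getVert i ≠ p.getVert j := by
    intro i j hi hj hij hh
    exact hij (hp.getVert_injOn (by simpa [hl] using hi) (by simpa [hl] using hj) hh)
  have g0 : p.getVert 0 = v := p.getVert_zero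
  have g3 : p.getVert 3 = u := by rw [← hl]; exact p.getVert_length
  have d01 := inj 0 1 (by omega) (by omega) (by omega)
  have d02 := inj 0 2 (by omega) (by omega) (by omega)
  have d03 := inj 0 3 (by omega) (by omega) (by omega)
  have d12 := inj 1 2 (by omega) (by omega) (by omega)
  have d13 := inj 1 3 (by omega) (by omega) (by omega)
  have d23 := inj 2 3 (by omega) (by omega) (by omega)
  have e0 := p.adj_getVert_succ (i := 0) (by omega)
  have e1 := p.adj_getVert_succ (i := 1) (by omega)
  have e2 := p.adj_getVert_succ (i := 2) (by omega)
  norm_num at e0 e1 e2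
  rw [g0] at d01 d02 d03
  rw [g3] at d03 d13 d23 e2
  have t1 := hdeg _ (p.getVert_mem_support 1) d01.symm d13
  have t2 := hdeg _ (p.getVert_mem_support 2) d02.symm d23
  exact ⟨p.getVert 2, e0, d01, d02, d03, d12, d13, d23, deg_two t1 e0.symm e1 d02,
    deg_two t2 e1.symm e2 d13, t1, t2⟩

/-- For every `k ≥ 0`, no smallest counterexample contains a
`(2,2,k)`-vertex: a vertex of degree three that is an end of two 2-strings and a
`k`-string. -/
theorem smallestCex_no_22k_vertex {V : Type} [Fintype V] (G : SimpleGraph V)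
    (h : SmallestCex G) (k : ℕ) :
    ¬ ∃ (v u1 u2 u3 : V) (p1 : G.Walk v u1) (p2 : G.Walk v u2) (p3 : G.Walk v u3),
      deg G v = 3 ∧ IsString G p1 ∧ IsString G p2 ∧ IsString G p3 ∧
      p1.getVert 1 ≠ p2.getVert 1 ∧ p1.getVert 1 ≠ p3.getVert 1 ∧
      p2.getVert 1 ≠ p3.getVert 1 ∧
      p1.length = 2 + 1 ∧ p2.length = 2 + 1 ∧ p3.length = k + 1 := by
  rintro ⟨v, u1, u2, u3, w1, w2, w3, hdv, hs1, hs2, hs3, h12, h13, h23, hl1, hl2, hl3⟩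
  have hd1 := hs1.2.2.2.1
  have hd2 := hs2.2.2.2.1
  obtain ⟨a2, va, va1, va2, vu1, a12, a1u, a2u, ha1, ha2, da1, da2⟩ := string3 w1 hs1 hl1
  obtain ⟨b2, vb, vb1, vb2, vu2, b12, b1u, b2u, hb1, hb2, db1, db2⟩ := string3 w2 hs2 hl2
  have hc : G.Adj v (w3.getVert 1) := by
    have := w3.adj_getVert_succ (i := 0) (by omega)
    simpa using this
  have hv := deg_three hdv va vb hc h12 h13 h23
  generalize w1.getVert 1 = a1 at *
  generalize w2.getVert 1 = b1 at *
  generalize w3.getVert 1 = c at *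
  have ne_of_deg : ∀ x y, 3 ≤ deg G x → deg G y = 2 → x ≠ y := by
    rintro x y hx hy rfl
    omega
  have a2b1 : a2 ≠ b1 := by
    rintro rfl
    rcases (ha2 v).1 vb.symm with h1 | h1
    · exact va1 h1
    · exact vu1 h1
  have a1b2 : a1 ≠ b2 := by
    rintro rfl
    rcases (hb2 v).1 va.symm with h1 | h1
    · exact vb1 h1
    · exact vu2 h1
  have a2b2 : a2 ≠ b2 := by
    rintro rfl
    rcases (hb2 a1).1 ((ha2 a1).2 (Or.inl rfl)) with h1 | h1
    · exact h12 h1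
    · exact ne_of_deg u2 a1 hd2 da1 h1.symm
  have ca2 : c ≠ a2 := by
    rintro rfl
    rcases (ha2 v).1 hc.symm with h1 | h1
    · exact va1 h1
    · exact vu1 h1
  have cb2 : c ≠ b2 := by
    rintro rfl
    rcases (hb2 v).1 hc.symm with h1 | h1
    · exact vb1 h1
    · exact vu2 h1
  have cfg : Cfg G v a1 a2 u1 b1 b2 u2 c :=
    ⟨hv, ha1, ha2, hb1, hb2, ⟨va1, va2, vb1, vb2⟩, ⟨a12, h12, a1b2, a2b1, a2b2, b12⟩,
      ⟨vu1.symm, a1u.symm, a2u.symm, ne_of_deg _ _ hd1 db1, ne_of_deg _ _ hd1 db2⟩,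
      ⟨vu2.symm, ne_of_deg _ _ hd2 da1, ne_of_deg _ _ hd2 da2, b1u.symm, b2u.symm⟩,
      ⟨hc.ne.symm, h13.symm, ca2, h23.symm, cb2⟩⟩
  exact cfg.false h hd1 hd2
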